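/- Let G be a boundedly endo-rigid abelian group with #G > 2^ℵ₀. Then G is co-Hopfian if and only if Qr_*(G) holds. -/

import Mathlib

open Cardinal

/-- The `n`-power torsion subgroup `Γ_n(G) = {g : ∃ k, n ^ k • g = 0}`. -/
def Gamma (G : Type*) [AddCommGroup G] (n : ℕ) : AddSubgroup G where
  carrier := {g | ∃ k : ℕ, n ^ k • g = 0}
  zero_mem' := ⟨0, smul_zero _⟩
  add_mem' := by
    intro a b ha hb
    obtain ⟨k, hk⟩ := ha
    obtain ⟨l, hl⟩ := hb
    refine ⟨k + l, ?_⟩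
    have ha' : n ^ (k + l) • a = 0 := by rw [pow_add, mul_comm, mul_smul, hk, smul_zero]
    have hb' : n ^ (k + l) • b = 0 := by rw [pow_add, mul_smul, hl, smul_zero]
    rw [smul_add, ha', hb', add_zero]
  neg_mem' := by
    intro a ha
    obtain ⟨k, hk⟩ := ha
    exact ⟨k, by rw [smul_neg, hk, neg_zero]⟩

/-- The torsion subgroup `tor(G)` of `G`. -/
def torsionSub (G : Type*) [AddCommGroup G] : AddSubgroup G where
  carrier := {g | ∃ k : ℕ, 0 < k ∧ k • g = 0}
  zero_mem' := ⟨1, one_pos, smul_zero _⟩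
  add_mem' := by
    intro a b ha hb
    obtain ⟨k, hk, hka⟩ := ha
    obtain ⟨l, hl, hlb⟩ := hb
    refine ⟨k * l, Nat.mul_pos hk hl, ?_⟩
    have ha' : (k * l) • a = 0 := by rw [mul_comm, mul_smul, hka, smul_zero]
    have hb' : (k * l) • b = 0 := by rw [mul_smul, hlb, smul_zero]
    rw [smul_add, ha', hb', add_zero]
  neg_mem' := by
    intro a ha
    obtain ⟨k, hk, hka⟩ := ha
    exact ⟨k, hk, by rw [smul_neg, hka, neg_zero]⟩

/-- A homomorphism of abelian groups is bounded when its range is a bounded group. -/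
def HasBoundedRange {G H : Type*} [AddCommGroup G] [AddCommGroup H] (f : G →+ H) : Prop :=
  ∃ n : ℕ, 1 ≤ n ∧ ∀ x, n • f x = 0

/-- `G` is boundedly endo-rigid: every endomorphism is `m • id` plus a bounded map. -/
def BoundedlyEndoRigid (G : Type*) [AddCommGroup G] : Prop :=
  ∀ f : G →+ G, ∃ m : ℤ, ∃ n : ℕ, 1 ≤ n ∧ ∀ x : G, n • (f x - m • x) = 0

/-- `G` is co-Hopfian: every injective endomorphism is surjective. -/
def CoHopfian (G : Type*) [AddCommGroup G] : Prop :=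
  ∀ f : G →+ G, Function.Injective f → Function.Surjective f

/-- A subgroup is bounded if some `n ≥ 1` kills all its elements. -/
def IsBoundedSubgroup {G : Type*} [AddCommGroup G] (A : AddSubgroup G) : Prop :=
  ∃ n : ℕ, 1 ≤ n ∧ ∀ x ∈ A, n • x = 0

/-- A subgroup is divisible if each of its elements is divisible, within the
subgroup, by every `n ≥ 1`. -/
def DivisibleSubgroup {G : Type*} [AddCommGroup G] (A : AddSubgroup G) : Prop :=
  ∀ n : ℕ, 0 < n → ∀ a ∈ A, ∃ b ∈ A, n • b = a

/-- A group is reduced if its only divisible subgroup is `0`. -/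
def Reduced (G : Type*) [AddCommGroup G] : Prop :=
  ∀ A : AddSubgroup G, DivisibleSubgroup A → A = ⊥

/-- A subgroup `A ≤ G` is pure if `nG ∩ A = nA` for all integers `n`. -/
def IsPureSubgroup {G : Type*} [AddCommGroup G] (A : AddSubgroup G) : Prop :=
  ∀ n : ℤ, ∀ a ∈ A, (∃ g : G, n • g = a) → ∃ b ∈ A, n • b = a

/-- The restriction of an endomorphism of `G` mapping `Γ_n(G)` into itself. -/
def restrictGamma {G : Type*} [AddCommGroup G] (n : ℕ) (h : G →+ G)
    (hmem : ∀ x ∈ Gamma G n, h x ∈ Gamma G n) : Gamma G n →+ Gamma G n where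
  toFun x := ⟨h x.1, hmem x.1 x.2⟩
  map_zero' := Subtype.ext (by simp)
  map_add' x y := Subtype.ext (by simp)

/-- An `(m, n)`-anti-witness for `G` (for `m ∣ n`): a bounded endomorphism `h` of
`Γ_n(G)` such that `h' = m • id + h` is injective, and either `h'` is not surjective, or
`m > 1` and `G/Γ_n(G)` is not `m`-divisible. -/
def IsAntiWitness (G : Type*) [AddCommGroup G] (m n : ℕ) (h : Gamma G n →+ Gamma G n) : Prop :=
  (∃ k : ℕ, 1 ≤ k ∧ ∀ x, k • h x = 0) ∧
  Function.Injective (fun x : Gamma G n => m • x + h x) ∧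
  (¬ Function.Surjective (fun x : Gamma G n => m • x + h x) ∨
    (1 < m ∧ ¬ (∀ y : G ⧸ Gamma G n, ∃ z, m • z = y)))

/-- `NQr_{(m,n)}(G)`: there exists an `(m,n)`-anti-witness. -/
def NQrAt (G : Type*) [AddCommGroup G] (m n : ℕ) : Prop :=
  ∃ h : Gamma G n →+ Gamma G n, IsAntiWitness G m n h

/-- `NQr(G)`: `NQr_{(m,n)}(G)` for some `m, n ≥ 1` with `m ∣ n`. -/
def NQr (G : Type*) [AddCommGroup G] : Prop :=
  ∃ m n : ℕ, 1 ≤ m ∧ 1 ≤ n ∧ m ∣ n ∧ NQrAt G m n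

/-- `Qr(G)`: the negation of `NQr(G)`. -/
def Qr (G : Type*) [AddCommGroup G] : Prop := ¬ NQr G

/-- `Qr_*(G)`: `Qr(G)` holds and `Γ_p(G)` is unbounded for at least one prime `p`. -/
def QrStar (G : Type*) [AddCommGroup G] : Prop :=
  Qr G ∧ ∃ p : ℕ, p.Prime ∧ ¬ IsBoundedSubgroup (Gamma G p)

/-- `S_G`: the set of primes `p` such that `G/Γ_p(G)` is not `p`-divisible. -/
def SGset (G : Type*) [AddCommGroup G] : Set ℕ :=
  {p | p.Prime ∧ ¬ (∀ y : G ⧸ Gamma G p, ∃ z : G ⧸ Gamma G p, p • z = y)}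


/-- A homomorphism into a group of exponent `p ^ e`, defined on a subgroup of `G` and not
decreasing `p`-heights computed in `G`, extends to all of `G`. -/
theorem exists_extension_of_height_le {G B : Type*} [AddCommGroup G] [AddCommGroup B] {p : ℕ}
    (hp : p.Prime) (e : ℕ) (hB : ∀ b : B, p ^ e • b = 0) (A : AddSubgroup G) (f : A →+ B)
    (hf : ∀ (i : ℕ) (a : A), (∃ g : G, p ^ i • g = a) → ∃ b, p ^ i • b = f a) :
    ∃ F : G →+ B, ∀ a : A, F a = f a := by
  let Q : AddSubgroup (G × B) → Prop := fun S =>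
    ∀ z ∈ S, ∀ i : ℕ, (∃ g, p ^ i • g = z.1) → ∃ b, p ^ i • b = z.2
  let S₀ : AddSubgroup (G × B) := (A.subtype.prod f).range
  have hS₀ : Q S₀ := by
    rintro _ ⟨a, rfl⟩ i hg
    exact hf i a hg
  obtain ⟨S, hS₀S, hS⟩ := zorn_le_nonempty₀ {S | Q S} (by
    intro c hc hchain S hS
    refine ⟨sSup c, ?_, fun T hT => le_sSup hT⟩
    intro z hz i hg
    rw [AddSubgroup.mem_sSup_of_directedOn ⟨S, hS⟩ hchain.directedOn] at hz
    obtain ⟨T, hT, hzT⟩ := hz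
    exact hc hT z hzT i hg) S₀ hS₀
  have hQ : Q S := hS.prop
  have adjoin : ∀ (x : G) (y : B), (∀ (i : ℕ) (n : ℤ) (a : G) (b : B), (a, b) ∈ S →
      (∃ g, p ^ i • g = a + n • x) → ∃ c, p ^ i • c = b + n • y) → (x, y) ∈ S := by
    intro x y h
    have hT : Q (S ⊔ AddSubgroup.zmultiples (x, y)) := by
      intro z hz i hg
      obtain ⟨⟨a, b⟩, hab, w, hw, rfl⟩ := AddSubgroup.mem_sup.1 hz
      obtain ⟨n, rfl⟩ := AddSubgroup.mem_zmultiples_iff.1 hw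
      exact h i n a b hab hg
    exact hS.le_of_ge hT le_sup_left
      ((le_sup_right : _ ≤ S ⊔ AddSubgroup.zmultiples (x, y)) (AddSubgroup.mem_zmultiples (x, y)))
  have hpow : ∀ g : G, (p ^ e • g, (0 : B)) ∈ S := by
    intro g
    refine adjoin _ _ fun i n a b hab hg => ?_
    obtain ⟨w, hw⟩ := hg
    rw [smul_zero, add_zero]
    rcases le_total i e with hi | hi
    · refine hQ _ hab i ⟨w - n • p ^ (e - i) • g, ?_⟩
      have : p ^ i • n • p ^ (e - i) • g = n • p ^ e • g := by
        rw [smul_comm (p ^ i) n, smul_smul (p ^ i), ← pow_add, Nat.add_sub_cancel' hi]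
      rw [smul_sub, this, hw, add_sub_cancel_right]
    · obtain ⟨c, hc⟩ := hQ _ hab e ⟨p ^ (i - e) • w - n • g, by
        rw [smul_sub, smul_smul, ← pow_add, Nat.add_sub_cancel' hi, hw, smul_comm (p ^ e) n,
          add_sub_cancel_right]⟩
      rw [hB] at hc
      exact ⟨0, by rw [smul_zero]; exact hc⟩
  have hdiv : ∀ x : G, (∃ b, (p • x, b) ∈ S) → ∃ y, (x, y) ∈ S := by
    intro x₀ ⟨b₀, hb₀⟩
    by_contra hx₀
    let R : ℕ → Prop := fun j => ∃ a b, (a, b) ∈ S ∧ ∃ g, p ^ j • g = x₀ + a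
    have hR₀ : R 0 := ⟨0, 0, S.zero_mem, x₀, by simp⟩
    have hRe : ¬ R e := by
      rintro ⟨a, b, hab, g, hg⟩
      have := S.sub_mem (hpow g) hab
      exact hx₀ ⟨0 - b, by simpa [hg] using this⟩
    obtain ⟨j, hj, hj'⟩ : ∃ j, R j ∧ ¬ R (j + 1) := by
      by_contra! h
      exact hRe (Nat.rec hR₀ h e)
    obtain ⟨a₁, b₁, hab₁, g, hg⟩ := hj
    have hpx : (p • (x₀ + a₁), b₀ + p • b₁) ∈ S := by
      have := S.add_mem hb₀ (S.nsmul_mem hab₁ p)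
      simpa [smul_add] using this
    obtain ⟨c, hc⟩ := hQ _ hpx (j + 1) ⟨g, by rw [pow_succ', mul_smul, hg]⟩
    have hpy : p • p ^ j • c = b₀ + p • b₁ := by rw [smul_smul, ← pow_succ']; exact hc
    have key : (x₀ + a₁, p ^ j • c) ∈ S := by
      refine adjoin _ _ fun i n a b hab hw => ?_
      by_cases hn : (p : ℤ) ∣ n
      · obtain ⟨k, rfl⟩ := hn
        refine hQ (a + ((p : ℤ) * k) • (x₀ + a₁), b + ((p : ℤ) * k) • p ^ j • c) ?_ i hw
        have := S.add_mem hab (S.zsmul_mem hpx k)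
        rw [← hpy] at this
        simpa only [Prod.smul_mk, Prod.mk_add_mk, mul_comm (p : ℤ) k, mul_smul,
          natCast_zsmul] using this
      · obtain ⟨w, hw⟩ := hw
        have hij : i ≤ j := by
          by_contra! hij
          obtain ⟨u, v, huv⟩ : IsCoprime (p : ℤ) n :=
            (Nat.prime_iff_prime_int.1 hp).coprime_iff_not_dvd.2 hn
          apply hj'
          refine ⟨a₁ + v • a - u • p • (x₀ + a₁), b₁ + v • b - u • (b₀ + p • b₁),
            S.sub_mem (S.add_mem hab₁ (S.zsmul_mem hab v)) (S.zsmul_mem hpx u),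
            v • p ^ (i - (j + 1)) • w, ?_⟩
          rw [smul_comm _ v, smul_smul (p ^ (j + 1)), ← pow_add, Nat.add_sub_cancel' hij, hw]
          have h1 : x₀ + a₁ = (u * p + v * n) • (x₀ + a₁) := by rw [huv, one_smul]
          rw [← natCast_zsmul (x₀ + a₁) p]
          have h2 : x₀ + (a₁ + v • a - u • (p : ℤ) • (x₀ + a₁))
            = (x₀ + a₁) + v • a - u • (p : ℤ) • (x₀ + a₁) := by abel
          rw [h2]
          nth_rewrite 2 [h1]
          module
        have e1 : p ^ i • p ^ (j - i) • g = x₀ + a₁ := by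
          rw [smul_smul, ← pow_add, Nat.add_sub_cancel' hij, hg]
        obtain ⟨d, hd⟩ := hQ _ hab i ⟨w - n • p ^ (j - i) • g, by
          rw [smul_sub, hw, smul_comm _ n, e1, add_sub_cancel_right]⟩
        refine ⟨d + n • p ^ (j - i) • c, ?_⟩
        rw [smul_add, hd, smul_comm _ n, smul_smul (p ^ i), ← pow_add, Nat.add_sub_cancel' hij]
    exact hx₀ ⟨p ^ j • c - b₁, by simpa using S.sub_mem key hab₁⟩
  have htotal : ∀ x : G, ∃ y, (x, y) ∈ S := by
    intro x
    have : ∀ i, (∃ y, (p ^ i • x, y) ∈ S) → ∃ y, (x, y) ∈ S := by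
      intro i
      induction i with
      | zero => simp
      | succ i ih =>
        intro h
        exact ih (hdiv _ (by simpa only [pow_succ', mul_smul] using h))
    exact this e ⟨0, hpow x⟩
  have huniq : ∀ x y y', (x, y) ∈ S → (x, y') ∈ S → y = y' := by
    intro x y y' h h'
    obtain ⟨c, hc⟩ := hQ _ (S.sub_mem h h') e ⟨0, by simp⟩
    rw [hB] at hc
    exact sub_eq_zero.1 hc.symm
  choose F hF using htotal
  exact ⟨AddMonoidHom.mk' F fun x y => huniq _ _ _ (hF _) (S.add_mem (hF x) (hF y)),
    fun a => huniq _ _ _ (hF _) (hS₀S ⟨a, rfl⟩)⟩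

/-- A homomorphism of finite exponent defined on a pure subgroup extends to the whole group. -/
theorem exists_extension_of_pure {G B : Type*} [AddCommGroup G] [AddCommGroup B]
    (A : AddSubgroup G) (hA : ∀ (p : ℕ), p.Prime → ∀ (i : ℕ), ∀ a ∈ A, (∃ g : G, p ^ i • g = a) →
      ∃ b ∈ A, p ^ i • b = a) (k : ℕ) (hk : 0 < k) :
    ∀ f : A →+ B, (∀ a, k • f a = 0) →
      ∃ F : G →+ B, (∀ x, k • F x = 0) ∧ ∀ a : A, F a = f a := by
  induction k using Nat.recOnPosPrimePosCoprime with
  | zero => omega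
  | one =>
    intro f hf
    exact ⟨0, by simp, fun a => by simpa using (hf a).symm⟩
  | prime_pow p e hp he =>
    intro f hf
    let C : AddSubgroup B := (nsmulAddMonoidHom (p ^ e) : B →+ B).ker
    obtain ⟨F, hF⟩ := exists_extension_of_height_le hp e (B := C)
      (fun b => Subtype.ext b.2) A (f.codRestrict C hf) (by
        intro i a hg
        obtain ⟨b, hb, hba⟩ := hA p hp i a a.2 hg
        refine ⟨f.codRestrict C hf ⟨b, hb⟩, ?_⟩
        rw [← map_nsmul]
        exact congrArg _ (Subtype.ext hba))
    exact ⟨C.subtype.comp F, fun x => (F x).2, fun a => congrArg Subtype.val (hF a)⟩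
  | coprime a b ha hb hab iha ihb =>
    intro f hf
    obtain ⟨u, v, huv⟩ := Nat.isCoprime_iff_coprime.2 hab
    obtain ⟨F₁, hF₁, hF₁'⟩ := iha (by omega) ((v * b) • f) (fun x => by
      have := hf x
      rw [AddMonoidHom.smul_apply, mul_smul, natCast_zsmul, smul_comm a v, smul_smul a b, this,
        smul_zero])
    obtain ⟨F₂, hF₂, hF₂'⟩ := ihb (by omega) ((u * a) • f) (fun x => by
      have := hf x
      rw [AddMonoidHom.smul_apply, mul_smul, natCast_zsmul, smul_comm b u, smul_smul b a,
        mul_comm b a, this, smul_zero])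
    refine ⟨F₁ + F₂, fun x => ?_, fun x => ?_⟩
    · rw [AddMonoidHom.add_apply, smul_add, mul_comm a b, mul_smul, hF₁, mul_comm b a, mul_smul,
        hF₂, smul_zero, smul_zero, add_zero]
    · rw [AddMonoidHom.add_apply, hF₁', hF₂', AddMonoidHom.smul_apply, AddMonoidHom.smul_apply,
        ← add_smul, add_comm, huv, one_smul]

/-- An infinite vector space has an injective endomorphism that is not surjective. -/
theorem exists_injective_not_surjective_of_infinite (K : Type*) {U : Type*} [Field K] [Finite K]
    [AddCommGroup U] [Module K U] [Infinite U] :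
    ∃ s : U →ₗ[K] U, Function.Injective s ∧ ¬ Function.Surjective s := by
  have hrank : Cardinal.aleph0 ≤ Module.rank K U := by
    by_contra! h
    have := Module.rank_lt_aleph0_iff.1 h
    exact not_finite_iff_infinite.2 ‹Infinite U› (Module.finite_of_finite K)
  obtain ⟨ι, ⟨b⟩⟩ : ∃ ι : Type _, Nonempty (Module.Basis ι K U) :=
    ⟨_, ⟨Module.Basis.ofVectorSpace K U⟩⟩
  have hι : Infinite ι := by
    rw [Cardinal.infinite_iff, b.mk_eq_rank'']
    exact hrank
  obtain ⟨e⟩ : Nonempty (ι ≃ Option ι) :=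
    Cardinal.eq.1 (by rw [Cardinal.mk_option, Cardinal.add_one_eq (Cardinal.infinite_iff.1 hι)])
  let σ : ι → ι := fun i => e.symm (some i)
  have hσ : Function.Injective σ := e.symm.injective.comp (Option.some_injective ι)
  have hbσ : ∀ i, b.constr K (b ∘ σ) (b i) = b (σ i) := fun i => by simp
  refine ⟨b.constr K (b ∘ σ), ?_, fun hsurj => ?_⟩
  · exact b.injective_constr_of_linearIndependent (b.linearIndependent.comp σ hσ)
  · have hcoord : (b.coord (e.symm none)).comp (b.constr K (b ∘ σ)) = 0 := by
      refine b.ext fun i => ?_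
      have hne : σ i ≠ e.symm none := fun h => by simpa using e.symm.injective h
      simp [Finsupp.single_eq_of_ne, hne.symm]
    obtain ⟨u, hu⟩ := hsurj (b (e.symm none))
    have := LinearMap.congr_fun hcoord u
    simp [hu] at this

/-- An infinite vector space with a descending chain of subspaces from `⊤` to `⊥` has an
injective, non-surjective endomorphism preserving every member of the chain. -/
theorem exists_injective_not_surjective_of_antitone {K V : Type*} [Field K] [Finite K]
    [AddCommGroup V] [Module K V] [Infinite V] (S : ℕ → Submodule K V) (hS : Antitone S)
    (h0 : S 0 = ⊤) {e : ℕ} (he : S e = ⊥) :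
    ∃ f : V →ₗ[K] V, Function.Injective f ∧ ¬ Function.Surjective f ∧
      ∀ i, ∀ x ∈ S i, f x ∈ S i := by
  obtain ⟨i, hi, hi'⟩ : ∃ i, Infinite (S i) ∧ ¬ Infinite (S (i + 1)) := by
    by_contra! h
    have h0' : Infinite (S 0) := by
      rw [h0]
      exact Infinite.of_injective (fun v : V => (⟨v, trivial⟩ : (⊤ : Submodule K V)))
        fun a b hab => congrArg Subtype.val hab
    have : Infinite (S e) := Nat.rec h0' h e
    rw [he] at this
    exact not_finite (⊥ : Submodule K V)
  obtain ⟨U, hdisj, hsup⟩ := IsModularLattice.exists_disjoint_and_sup_eq (hS (Nat.le_succ i))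
  obtain ⟨T, hT, hTU⟩ := hdisj.exists_isCompl
  have hUS : U ≤ S i := hsup ▸ le_sup_right
  have hU : Infinite U := by
    by_contra hU
    rw [not_infinite_iff_finite] at hU hi'
    have h1 : Module.Finite K U := inferInstance
    have h2 : Module.Finite K (S (i + 1)) := inferInstance
    have h3 : Module.Finite K (S (i + 1) ⊔ U : Submodule K V) := Submodule.finite_sup _ _
    rw [Nat.succ_eq_add_one] at hsup
    rw [hsup] at h3
    have : Finite (S i) := Module.finite_of_finite K
    exact not_finite (S i)
  obtain ⟨s, hs, hs'⟩ := exists_injective_not_surjective_of_infinite K (U := U)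
  let r : V →ₗ[K] U := Submodule.projectionOnto U T hTU.symm
  have hr : ∀ u : U, r u = u := fun u => Submodule.projectionOnto_apply_left hTU.symm u
  have hr0 : ∀ x, r x = 0 → x ∈ T := fun x hx =>
    (Submodule.projectionOnto_apply_eq_zero_iff hTU.symm).1 hx
  have hrT : ∀ x ∈ T, r x = 0 := fun x hx =>
    (Submodule.projectionOnto_apply_eq_zero_iff hTU.symm).2 hx
  let f : V →ₗ[K] V := LinearMap.id + U.subtype ∘ₗ (s - LinearMap.id) ∘ₗ r
  have hf : ∀ x, f x = x + ((s (r x) - r x : U) : V) := fun x => rfl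
  have hrf : ∀ x, r (f x) = s (r x) := by
    intro x
    rw [hf, map_add, hr]
    abel
  refine ⟨f, ?_, ?_, ?_⟩
  · rw [injective_iff_map_eq_zero]
    intro x hx
    have h1 : r x = 0 := (injective_iff_map_eq_zero s).1 hs _ (by rw [← hrf, hx, map_zero])
    simpa [hf, h1] using hx
  · intro hsurj
    refine hs' fun u => ?_
    obtain ⟨x, hx⟩ := hsurj u
    exact ⟨r x, by rw [← hrf, hx, hr]⟩
  · intro j x hx
    rw [hf]
    rcases le_or_gt j i with hj | hj
    · exact (S j).add_mem hx (hS hj (hUS (Subtype.mem _)))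
    · rw [hrT x (hT (hS hj hx))]
      simpa using hx

/-- An infinite elementary abelian `p`-group with a descending chain of subgroups from `⊤` to `⊥`
has an injective, non-surjective endomorphism preserving every member of the chain. -/
theorem exists_injective_not_surjective_of_zmodModule {V : Type*} [AddCommGroup V] (p : ℕ)
    [Fact p.Prime] [Module (ZMod p) V] [Infinite V] (S : ℕ → AddSubgroup V) (hS : Antitone S)
    (h0 : S 0 = ⊤) {e : ℕ} (he : S e = ⊥) :
    ∃ f : V →+ V, Function.Injective f ∧ ¬ Function.Surjective f ∧
      ∀ i, ∀ x ∈ S i, f x ∈ S i := by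
  obtain ⟨f, hf⟩ := exists_injective_not_surjective_of_antitone (K := ZMod p)
    (fun i => AddSubgroup.toZModSubmodule p (S i))
    (fun i j hij => (AddSubgroup.toZModSubmodule p).monotone (hS hij))
    (by rw [h0, map_top]) (e := e) (by rw [he, map_bot])
  exact ⟨f.toAddMonoidHom, hf⟩

/-- A co-Hopfian `p`-group of finite exponent is finite. -/
theorem CoHopfian.finite_of_bounded {A : Type*} [AddCommGroup A] (hA : CoHopfian A) {p : ℕ}
    (hp : p.Prime) {e : ℕ} (he : ∀ a : A, p ^ e • a = 0) : Finite A := by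
  by_contra hfin
  rw [not_finite_iff_infinite] at hfin
  have : Fact p.Prime := ⟨hp⟩
  let V : AddSubgroup A := (nsmulAddMonoidHom p : A →+ A).ker
  have hpV : ∀ v : V, p • v = 0 := fun v => Subtype.ext v.2
  have hV : Infinite V := by
    by_contra hV
    rw [not_infinite_iff_finite] at hV
    have hker : ∀ i : ℕ, {a : A | p ^ i • a = 0}.Finite := by
      intro i
      induction i with
      | zero => simp
      | succ i ih =>
        have : {a : A | p ^ (i + 1) • a = 0} = (fun a => p • a) ⁻¹' {a : A | p ^ i • a = 0} := by
          ext a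
          simp [pow_succ, mul_smul]
        rw [this]
        refine ih.preimage' fun b _ => ?_
        by_cases hb : ∃ c : A, p • c = b
        · obtain ⟨c, rfl⟩ := hb
          refine (Set.finite_range fun v : V => (v : A) + c).subset fun a ha => ?_
          refine ⟨⟨a - c, ?_⟩, sub_add_cancel a c⟩
          have : p • a = p • c := ha
          change p • (a - c) = 0
          rw [smul_sub, this, sub_self]
        · convert Set.finite_empty
          ext a
          simpa using fun h => hb ⟨a, h⟩
    have huniv : {a : A | p ^ e • a = 0} = Set.univ := by
      ext a
      simpa using he a
    exact Set.infinite_univ (huniv ▸ hker e)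
  let S : ℕ → AddSubgroup V := fun i =>
    AddSubgroup.comap V.subtype (nsmulAddMonoidHom (p ^ i) : A →+ A).range
  have hmem : ∀ i v, v ∈ S i ↔ ∃ a : A, p ^ i • a = v := fun i v => Iff.rfl
  have hmod : Module (ZMod p) V := AddCommGroup.zmodModule hpV
  obtain ⟨f₀, hinj, hsurj, hf₀⟩ := exists_injective_not_surjective_of_zmodModule p S
    (by
      intro i j hij v hv
      rw [hmem] at hv ⊢
      obtain ⟨a, ha⟩ := hv
      exact ⟨p ^ (j - i) • a, by rw [smul_smul, ← pow_add, Nat.add_sub_cancel' hij, ha]⟩)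
    (by
      refine eq_top_iff.2 fun v _ => ?_
      rw [hmem]
      exact ⟨v, by simp⟩)
    (e := e) (by
      refine eq_bot_iff.2 fun v hv => ?_
      obtain ⟨a, ha⟩ := (hmem e v).1 hv
      rw [he] at ha
      exact Subtype.ext ha.symm)
  obtain ⟨F, hF⟩ := exists_extension_of_height_le hp e he V (V.subtype.comp f₀)
    (fun i a hg => (hmem i _).1 (hf₀ i a ((hmem i a).2 hg)))
  have hF' : ∀ v : V, F v = f₀ v := hF
  have hFinj : ∀ i : ℕ, ∀ a : A, p ^ i • a = 0 → F a = 0 → a = 0 := by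
    intro i
    induction i with
    | zero => intro a ha _; simpa using ha
    | succ i ih =>
      intro a ha hFa
      have hpa : p • a = 0 := ih (p • a) (by rw [smul_smul, ← pow_succ]; exact ha)
        (by rw [map_nsmul, hFa, smul_zero])
      have h1 : f₀ ⟨a, hpa⟩ = 0 := Subtype.ext (by rw [← hF']; exact hFa)
      exact congrArg Subtype.val ((injective_iff_map_eq_zero f₀).1 hinj _ h1)
  have hFinj' : Function.Injective F :=
    (injective_iff_map_eq_zero F).2 fun a => hFinj e a (he a)
  refine hsurj fun v => ?_
  obtain ⟨a, ha⟩ := hA F hFinj' v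
  have hpa : p • a = 0 := by
    apply hFinj'
    rw [map_nsmul, ha, map_zero]
    exact v.2
  exact ⟨⟨a, hpa⟩, Subtype.ext (by rw [← hF']; exact ha)⟩

theorem Gamma_pure {G : Type*} [AddCommGroup G] (n p : ℕ) (hp : p.Prime) (i : ℕ) (a : G)
    (ha : a ∈ Gamma G n) (hg : ∃ g : G, p ^ i • g = a) : ∃ b ∈ Gamma G n, p ^ i • b = a := by
  obtain ⟨l, hl⟩ := ha
  by_cases hpn : p ∣ n
  · obtain ⟨g, rfl⟩ := hg
    obtain ⟨q, rfl⟩ := hpn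
    refine ⟨g, ⟨l + i, ?_⟩, rfl⟩
    rw [pow_add, mul_pow p q i, mul_comm (p ^ i), mul_left_comm, mul_smul, mul_smul, hl, smul_zero]
  · obtain ⟨u, v, huv⟩ := Nat.isCoprime_iff_coprime.2
      (Nat.Coprime.pow l i ((hp.coprime_iff_not_dvd.2 hpn).symm))
    refine ⟨v • a, (Gamma G n).zsmul_mem ⟨l, hl⟩ v, ?_⟩
    calc p ^ i • v • a = u • n ^ l • a + v • p ^ i • a := by
          rw [hl, smul_zero, zero_add, smul_comm]
      _ = (u * (n ^ l : ℕ) + v * (p ^ i : ℕ)) • a := by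
          rw [add_smul, mul_smul, mul_smul, natCast_zsmul, natCast_zsmul]
      _ = a := by rw [huv, one_smul]

/-- The elements of `Γ_n(G)` annihilated by a fixed `k ≥ 1` are annihilated by a fixed power of `n`. -/
theorem exists_pow_smul_eq_zero {G : Type*} [AddCommGroup G] (n : ℕ) {k : ℕ} (hk : 1 ≤ k) :
    ∃ j : ℕ, ∀ x ∈ Gamma G n, k • x = 0 → n ^ j • x = 0 := by
  refine ⟨k, fun x ⟨l, hl⟩ hkx => ?_⟩
  have h1 : addOrderOf x ∣ n ^ l := addOrderOf_dvd_of_nsmul_eq_zero hl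
  have h2 : addOrderOf x ∣ k := addOrderOf_dvd_of_nsmul_eq_zero hkx
  apply addOrderOf_dvd_iff_nsmul_eq_zero.1
  have h0 : addOrderOf x ≠ 0 := fun h => by rw [h, zero_dvd_iff] at h2; omega
  have hle : addOrderOf x ≤ k := Nat.le_of_dvd hk h2
  rcases Nat.eq_zero_or_pos n with rfl | hn
  · rw [zero_pow (by omega)]
    exact dvd_zero _
  refine (Nat.factorization_le_iff_dvd h0 (by positivity)).1 fun q => ?_
  rcases Nat.eq_zero_or_pos ((addOrderOf x).factorization q) with h | h
  · rw [h]; exact Nat.zero_le _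
  · have hq : q.Prime := Nat.prime_of_mem_primeFactors (by
      rw [← Nat.support_factorization]; exact Finsupp.mem_support_iff.2 h.ne')
    have hqn : q ∣ n := hq.dvd_of_dvd_pow ((Nat.dvd_of_factorization_pos h.ne').trans h1)
    have h3 : 0 < n.factorization q := hq.factorization_pos_of_dvd hn.ne' hqn
    have h4 : (addOrderOf x).factorization q < addOrderOf x := Nat.factorization_lt q h0
    rw [Nat.factorization_pow]
    simp only [Finsupp.smul_apply, smul_eq_mul]
    nlinarith

theorem CoHopfian.qr {G : Type*} [AddCommGroup G] (hG : CoHopfian G) : Qr G := by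
  rintro ⟨m, n, hm, hn, ⟨q, rfl⟩, h, ⟨k, hk, hkh⟩, hinj, hor⟩
  obtain ⟨j, hj⟩ := exists_pow_smul_eq_zero (G := G) (m * q) hk
  have hj' : ∀ x, (m * q) ^ j • h x = 0 := fun x =>
    Subtype.ext (hj _ (h x).2 (congrArg Subtype.val (hkh x)))
  obtain ⟨F, hF0, hF⟩ := exists_extension_of_pure (Gamma G (m * q)) (Gamma_pure (m * q))
    ((m * q) ^ j) (pow_pos hn j) h hj'
  let f : G →+ G := m • AddMonoidHom.id G + (Gamma G (m * q)).subtype.comp F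
  have hf : ∀ x, f x = m • x + F x := fun x => rfl
  have hmem : ∀ x, f x ∈ Gamma G (m * q) → x ∈ Gamma G (m * q) := by
    intro x hx
    have h1 : m • x ∈ Gamma G (m * q) := by
      have := (Gamma G (m * q)).sub_mem hx (F x).2
      rwa [hf, add_sub_cancel_right] at this
    obtain ⟨l, hl⟩ := h1
    refine ⟨l + 1, ?_⟩
    rw [pow_succ, mul_comm m q, ← mul_assoc, mul_comm q m, mul_comm _ q, mul_assoc, mul_smul,
      mul_smul, hl, smul_zero]
  have hfG : ∀ x : Gamma G (m * q), f x = (m • x + h x : Gamma G (m * q)) := by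
    intro x
    rw [hf, hF]
    rfl
  have hfinj : Function.Injective f := by
    rw [injective_iff_map_eq_zero]
    intro x hx
    have hxG := hmem x (by rw [hx]; exact zero_mem _)
    have h2 : m • (⟨x, hxG⟩ : Gamma G (m * q)) + h ⟨x, hxG⟩ = 0 :=
      Subtype.ext (by rw [← hfG]; exact hx)
    have h3 : (⟨x, hxG⟩ : Gamma G (m * q)) = 0 := hinj (by simpa using h2)
    exact congrArg Subtype.val h3
  have hsurj := hG f hfinj
  rcases hor with hns | ⟨_, hnd⟩
  · refine hns fun y => ?_
    obtain ⟨x, hx⟩ := hsurj y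
    have hxG := hmem x (by rw [hx]; exact y.2)
    exact ⟨⟨x, hxG⟩, Subtype.ext (by rw [← hfG]; exact hx)⟩
  · refine hnd fun y => ?_
    obtain ⟨y, rfl⟩ := QuotientAddGroup.mk_surjective y
    obtain ⟨x, rfl⟩ := hsurj y
    refine ⟨x, ?_⟩
    rw [← QuotientAddGroup.mk_nsmul, QuotientAddGroup.eq, hf, neg_add_cancel_left]
    exact (F x).2

theorem QrStar.coHopfian {G : Type*} [AddCommGroup G] (hber : BoundedlyEndoRigid G)
    (hG : QrStar G) : CoHopfian G := by
  obtain ⟨hqr, p, hp, hunb⟩ := hG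
  have main : ∀ f : G →+ G, Function.Injective f → ∀ m n : ℕ, 1 ≤ n →
      (∀ x, n • (f x - m • x) = 0) → Function.Surjective f := by
    intro f hf m n hn hbd
    rcases Nat.eq_zero_or_pos m with rfl | hm
    · refine absurd ⟨n, hn, fun x _ => hf ?_⟩ hunb
      simpa using hbd x
    let N := m * n
    have hmem : ∀ x, f x - m • x ∈ Gamma G N := fun x =>
      ⟨1, by rw [pow_one, mul_smul, hbd, smul_zero]⟩
    let h : Gamma G N →+ Gamma G N :=
      restrictGamma N (f - m • AddMonoidHom.id G) fun x _ => hmem x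
    have hfh : ∀ x : Gamma G N, f x = (m • x + h x : Gamma G N) := fun x =>
      (add_sub_cancel (m • (x : G)) (f x)).symm
    have hN : ¬ NQrAt G m N := fun H =>
      hqr ⟨m, N, hm, Nat.mul_pos hm hn, dvd_mul_right m n, H⟩
    have hfac : Function.Surjective (fun x : Gamma G N => m • x + h x) ∧
        ∀ y : G ⧸ Gamma G N, ∃ z, m • z = y := by
      by_contra hcon
      refine hN ⟨h, ⟨n, hn, fun x => Subtype.ext (hbd x)⟩, fun x y hxy => ?_, ?_⟩
      · apply Subtype.ext
        apply hf
        rw [hfh, hfh]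
        exact congrArg Subtype.val hxy
      · by_cases hs : Function.Surjective (fun x : Gamma G N => m • x + h x)
        · have hd : ¬ ∀ y : G ⧸ Gamma G N, ∃ z, m • z = y := fun hd => hcon ⟨hs, hd⟩
          refine Or.inr ⟨lt_of_le_of_ne hm ?_, hd⟩
          rintro rfl
          exact hd fun y => ⟨y, one_smul _ y⟩
        · exact Or.inl hs
    obtain ⟨hs, hd⟩ := hfac
    intro y
    obtain ⟨z, hz⟩ := hd y
    obtain ⟨z, rfl⟩ := QuotientAddGroup.mk_surjective z
    rw [← QuotientAddGroup.mk_nsmul, QuotientAddGroup.eq] at hz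
    have h1 : y - f z ∈ Gamma G N := by
      have := (Gamma G N).sub_mem hz (hmem z)
      convert this using 1
      abel
    obtain ⟨w, hw⟩ := hs ⟨y - f z, h1⟩
    refine ⟨w + z, ?_⟩
    rw [map_add, hfh]
    have : ((m • w + h w : Gamma G N) : G) = y - f z := congrArg Subtype.val hw
    rw [this, sub_add_cancel]
  intro f hf
  obtain ⟨m, n, hn, hbd⟩ := hber f
  obtain ⟨k, rfl | rfl⟩ := m.eq_nat_or_neg
  · exact main f hf k n hn fun x => by simpa using hbd x
  · have := main (-f) (fun x y hxy => hf (by simpa using hxy)) k n hn fun x => by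
      have := hbd x
      rw [neg_smul, natCast_zsmul, sub_neg_eq_add] at this
      rw [AddMonoidHom.neg_apply, ← neg_add', smul_neg, this, neg_zero]
    intro y
    obtain ⟨x, hx⟩ := this (-y)
    exact ⟨x, by simpa using hx⟩

/-- In a group satisfying `Qr`, a bounded `p`-primary torsion subgroup is finite. -/
theorem Qr.finite_Gamma {G : Type*} [AddCommGroup G] (hG : Qr G) {p : ℕ} (hp : p.Prime)
    {e : ℕ} (he : ∀ x : Gamma G p, p ^ e • x = 0) : Finite (Gamma G p) := by
  refine CoHopfian.finite_of_bounded (fun f hf => ?_) hp he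
  by_contra hs
  refine hG ⟨1, p, le_rfl, hp.one_le, one_dvd p, f - AddMonoidHom.id _, ?_, ?_, Or.inl ?_⟩
  · exact ⟨p ^ e, Nat.pow_pos hp.pos, fun x => he _⟩
  · simpa using hf
  · simpa using hs

theorem Qr.exists_sub_mem_Gamma {G : Type*} [AddCommGroup G] (hG : Qr G) {p : ℕ} (hp : p.Prime)
    {e : ℕ} (he : ∀ x : Gamma G p, p ^ e • x = 0) (x : G) : ∃ z, x - p • z ∈ Gamma G p := by
  by_contra! hx
  refine hG ⟨p, p, hp.one_le, hp.one_le, dvd_rfl, AddMonoidHom.id _ - p • AddMonoidHom.id _,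
    ⟨p ^ e, Nat.pow_pos hp.pos, fun x => he _⟩, ?_, Or.inr ⟨hp.one_lt, fun h => ?_⟩⟩
  · intro a b hab
    simpa using hab
  · obtain ⟨z, hz⟩ := h x
    obtain ⟨z, rfl⟩ := QuotientAddGroup.mk_surjective z
    rw [← QuotientAddGroup.mk_nsmul, QuotientAddGroup.eq, neg_add_eq_sub] at hz
    exact hx z hz

/-- A boundedly endo-rigid group has no nonzero divisible torsion-free subgroup. -/
theorem BoundedlyEndoRigid.eq_bot_of_divisible {G : Type*} [AddCommGroup G]
    (hG : BoundedlyEndoRigid G) (D : AddSubgroup G) (hdiv : DivisibleSubgroup D)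
    (htf : ∀ k : ℕ, 0 < k → ∀ x ∈ D, k • x = 0 → x = 0) : D = ⊥ := by
  have htf' : ∀ k : ℕ, 0 < k → ∀ x : D, k • x = 0 → x = 0 := fun k hk x hx =>
    Subtype.ext (htf k hk x x.2 (congrArg Subtype.val hx))
  have hdiv' : ∀ n : ℕ, n ≠ 0 → Function.Surjective fun x : D => n • x := by
    intro n hn x
    obtain ⟨b, hb, hbx⟩ := hdiv n (Nat.pos_of_ne_zero hn) x x.2
    exact ⟨⟨b, hb⟩, Subtype.ext hbx⟩
  let _ : DivisibleBy D ℕ := divisibleByOfSMulRightSurj D ℕ fun {n} hn => hdiv' n hn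
  let _ : DivisibleBy D ℤ := AddGroup.divisibleByIntOfDivisibleByNat D
  have hinj : Module.Injective ℤ D := (Module.Baer.of_divisible D).injective
  obtain ⟨r, hr⟩ := hinj.out D.subtype.toIntLinearMap D.subtype_injective LinearMap.id
  have hr' : ∀ d : D, r d = d := hr
  have hbij : Function.Bijective (nsmulAddMonoidHom 2 : D →+ D) :=
    ⟨(injective_iff_map_eq_zero _).2 fun x hx => htf' 2 two_pos x hx, hdiv' 2 two_ne_zero⟩
  let half : D ≃+ D := (AddEquiv.ofBijective _ hbij).symm
  have hhalf : ∀ d : D, 2 • half d = d := fun d => (AddEquiv.ofBijective _ hbij).apply_symm_apply d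
  obtain ⟨m, n, hn, hbd⟩ := hG (D.subtype.comp (half.toAddMonoidHom.comp r.toAddMonoidHom))
  rw [eq_bot_iff]
  intro x hx
  have h1 : n • (half ⟨x, hx⟩ - m • (⟨x, hx⟩ : D)) = 0 := by
    apply Subtype.ext
    have := hbd x
    have h2 : r x = ⟨x, hx⟩ := hr' ⟨x, hx⟩
    simpa [h2] using this
  have h2 := htf' n hn _ h1
  have h3 : (1 - 2 * m) • (⟨x, hx⟩ : D) = 0 := by
    have h4 := hhalf ⟨x, hx⟩
    rw [sub_eq_zero.1 h2] at h4
    rw [sub_smul, one_smul, mul_smul, ofNat_zsmul, h4, sub_self]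
  have h4 : (1 - 2 * m).natAbs • (⟨x, hx⟩ : D) = 0 := by
    rcases (1 - 2 * m).natAbs_eq with h | h
    · rw [h, natCast_zsmul] at h3; exact h3
    · rw [h, neg_smul, natCast_zsmul, neg_eq_zero] at h3; exact h3
  exact congrArg Subtype.val (htf' _ (by omega) _ h4)

/-- A boundedly endo-rigid group satisfying `Qr` whose primary torsion subgroups are all bounded
has cardinality at most the continuum. -/
theorem Qr.card_le_of_bounded {G : Type*} [AddCommGroup G] (hqr : Qr G)
    (hber : BoundedlyEndoRigid G)
    (hbd : ∀ p : ℕ, p.Prime → IsBoundedSubgroup (Gamma G p)) : #G ≤ 2 ^ Cardinal.aleph0 := by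
  have hpow : ∀ p : Nat.Primes, ∃ e : ℕ, ∀ x : Gamma G p, (p : ℕ) ^ e • x = 0 := by
    intro p
    obtain ⟨k, hk, hkx⟩ := hbd p p.2
    obtain ⟨j, hj⟩ := exists_pow_smul_eq_zero (G := G) p hk
    exact ⟨j, fun x => Subtype.ext (hj x x.2 (hkx x x.2))⟩
  choose e he using hpow
  have hproj : ∀ p : Nat.Primes, ∃ F : G →+ Gamma G p, ∀ a : Gamma G p, F a = a := by
    intro p
    obtain ⟨F, -, hF⟩ := exists_extension_of_pure (Gamma G p) (Gamma_pure p) ((p : ℕ) ^ e p)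
      (Nat.pow_pos p.2.pos) (AddMonoidHom.id _) (he p)
    exact ⟨F, hF⟩
  choose π hπ using hproj
  have hfin : ∀ p : Nat.Primes, Finite (Gamma G p) := fun p => hqr.finite_Gamma p.2 (he p)
  have hcop : ∀ p q : Nat.Primes, q ≠ p → ∀ x ∈ Gamma G q, (p : ℕ) • x = 0 → x = 0 := by
    rintro p q hqp x ⟨l, hl⟩ hpx
    have hc : Nat.Coprime ((q : ℕ) ^ l) p :=
      Nat.Coprime.pow_left l ((Nat.coprime_primes q.2 p.2).2 fun h => hqp (Subtype.ext h))
    have := Nat.dvd_gcd (addOrderOf_dvd_of_nsmul_eq_zero hl) (addOrderOf_dvd_of_nsmul_eq_zero hpx)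
    rw [hc.gcd_eq_one, Nat.dvd_one, AddMonoid.addOrderOf_eq_one_iff] at this
    exact this
  let D : AddSubgroup G := ⨅ p, (π p).ker
  have hD : ∀ x, x ∈ D ↔ ∀ p, π p x = 0 := fun x => AddSubgroup.mem_iInf
  have htf : ∀ k : ℕ, 0 < k → ∀ x ∈ D, k • x = 0 → x = 0 := by
    intro k
    induction k using Nat.recOnMul with
    | zero => intro h; exact absurd h (lt_irrefl 0)
    | one => intro _ x _ hx; simpa using hx
    | prime p hp =>
      intro _ x hxD hx
      have hxG : x ∈ Gamma G p := ⟨1, by rw [pow_one, hx]⟩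
      have h1 := hπ ⟨p, hp⟩ ⟨x, hxG⟩
      rw [(hD x).1 hxD ⟨p, hp⟩] at h1
      exact (congrArg Subtype.val h1).symm
    | mul a b iha ihb =>
      intro hab x hxD hx
      rw [mul_smul] at hx
      exact ihb (Nat.pos_of_mul_pos_left hab) x hxD
        (iha (Nat.pos_of_mul_pos_right hab) _ (D.nsmul_mem hxD b) hx)
  have hdiv : DivisibleSubgroup D := by
    intro k
    induction k using Nat.recOnMul with
    | zero => intro h; exact absurd h (lt_irrefl 0)
    | one => exact fun _ x hx => ⟨x, hx, one_smul ℕ x⟩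
    | prime p hp =>
      intro _ x hx
      obtain ⟨P, rfl⟩ : ∃ P : Nat.Primes, (P : ℕ) = p := ⟨⟨p, hp⟩, rfl⟩
      obtain ⟨z, hz⟩ := hqr.exists_sub_mem_Gamma hp (he P) x
      have hzx : P.1 • (z - π P z) = x := by
        have h1 := hπ P ⟨_, hz⟩
        have h2 : π P (x - P.1 • z) = -(P.1 • π P z) := by
          rw [map_sub, (hD x).1 hx, zero_sub, map_nsmul]
        have h3 : x - P.1 • z = -(P.1 • (π P z : G)) :=
          congrArg Subtype.val (h1.symm.trans h2)
        rw [smul_sub, sub_eq_add_neg, ← h3, add_sub_cancel]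
      refine ⟨_, (hD _).2 fun q => ?_, hzx⟩
      by_cases hq : q = P
      · subst hq
        rw [map_sub, hπ, sub_self]
      · refine Subtype.ext (hcop P q hq _ (Subtype.mem _) ?_)
        have : P.1 • π q (z - π P z) = 0 := by
          rw [← map_nsmul, hzx]
          exact (hD x).1 hx q
        exact congrArg Subtype.val this
    | mul a b iha ihb =>
      intro hab x hx
      obtain ⟨y, hy, rfl⟩ := iha (Nat.pos_of_mul_pos_right hab) x hx
      obtain ⟨z, hz, rfl⟩ := ihb (Nat.pos_of_mul_pos_left hab) y hy
      exact ⟨z, hz, mul_smul a b z⟩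
  have hbot := hber.eq_bot_of_divisible D hdiv htf
  have hι : ∀ p : Nat.Primes, ∃ φ : Gamma G p → ℕ, Function.Injective φ := fun p =>
    (Countable.exists_injective_nat _)
  choose φ hφ using hι
  have hinj : Function.Injective fun (x : G) (p : Nat.Primes) => φ p (π p x) := by
    intro x y hxy
    have : x - y ∈ D := (hD _).2 fun p => by
      rw [map_sub, sub_eq_zero]
      exact hφ p (congrFun hxy p)
    rw [hbot, AddSubgroup.mem_bot, sub_eq_zero] at this
    exact this
  have := Cardinal.mk_le_of_injective ((Equiv.ulift.symm.injective.comp hinj))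
  refine this.trans (le_of_eq ?_)
  simp

/-- a boundedly endo-rigid abelian group of cardinality > 2^ℵ₀ is
co-Hopfian iff Qr_*(G) holds. -/
theorem stmt10 (G : Type*) [AddCommGroup G] (hber : BoundedlyEndoRigid G)
    (hcard : 2 ^ Cardinal.aleph0 < #G) :
    CoHopfian G ↔ QrStar G := by
  refine ⟨fun h => ⟨h.qr, ?_⟩, fun h => h.coHopfian hber⟩
  by_contra! hbd
  exact hcard.not_ge (h.qr.card_le_of_bounded hber hbd)
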